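/- Let A be a Hermitian n×n matrix over the split quaternion algebra H, let b ∈ H, and for an index i let A_{i.}(b·a_{i.}) denote the matrix obtained from A by left-multiplying every entry of its i-th row by b. Then for every i = 1,…,n, cdet_i A_{i.}(b·a_{i.}) = b · det A. -/

import Mathlib

/-- The split quaternion (coquaternion) algebra over ℝ:
`i² = −1`, `j² = 1`, `k² = 1`, `ij = −ji = k`. -/
abbrev SplitQuaternion : Type := QuaternionAlgebra ℝ (-1) 0 1

noncomputable section

namespace SplitQuaternion

variable {n : ℕ}

/-- The ordered product of entries of `A` along the cycle of `σ` containing `s`,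
read in the "row" direction:
`a_{s, σ s} * a_{σ s, σ² s} * ⋯ * a_{σ^{L−1} s, s}` where `L` is the cycle length. -/
def rowCycleProd (A : Matrix (Fin n) (Fin n) SplitQuaternion) (σ : Equiv.Perm (Fin n))
    (s : Fin n) : SplitQuaternion :=
  ((List.range (Function.minimalPeriod σ s)).map
    (fun m => A ((σ ^ m) s) ((σ ^ (m + 1)) s))).prod

/-- The ordered product of entries of `A` along the cycle of `σ` containing `s`,
read in the "column" direction:
`a_{s, σ^{L−1} s} * ⋯ * a_{σ² s, σ s} * a_{σ s, s}` where `L` is the cycle length. -/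
def colCycleProd (A : Matrix (Fin n) (Fin n) SplitQuaternion) (σ : Equiv.Perm (Fin n))
    (s : Fin n) : SplitQuaternion :=
  (((List.range (Function.minimalPeriod σ s)).map
    (fun m => A ((σ ^ (m + 1)) s) ((σ ^ m) s))).reverse).prod

open scoped Classical in
/-- The least elements of the cycles of `σ` other than the cycle containing `i`,
listed in increasing order. -/
def otherCycleMins (σ : Equiv.Perm (Fin n)) (i : Fin n) : List (Fin n) :=
  (Finset.univ.filter (fun s : Fin n =>
    (∀ t, σ.SameCycle s t → s ≤ t) ∧ ¬ σ.SameCycle i s)).sort (· ≤ ·)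

/-- The `i`-th row determinant of `A`: the sum over all permutations `σ` of
`(−1)^{n−r}` (which is `sign σ`, `r` being the number of disjoint cycles of `σ`,
fixed points included) times the product of the entries of `A` ordered according to
the left-ordered cycle notation of `σ` whose first cycle starts with `i`, every
other cycle starting with its least element, the cycles being ordered by
increasing least elements. -/
def rdet (A : Matrix (Fin n) (Fin n) SplitQuaternion) (i : Fin n) : SplitQuaternion :=
  ∑ σ : Equiv.Perm (Fin n),
    ((Equiv.Perm.sign σ : ℤ) : SplitQuaternion) *
      (rowCycleProd A σ i * ((otherCycleMins σ i).map (rowCycleProd A σ)).prod)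

/-- The `j`-th column determinant of `A`: the sum over all permutations `τ` of
`(−1)^{n−r}` times the product of the entries of `A` ordered according to the
right-ordered cycle notation of `τ` whose rightmost cycle ends with `j`, every
other cycle ending with its least element, the cycles being ordered (from right
to left) by increasing least elements. -/
def cdet (A : Matrix (Fin n) (Fin n) SplitQuaternion) (j : Fin n) : SplitQuaternion :=
  ∑ σ : Equiv.Perm (Fin n),
    ((Equiv.Perm.sign σ : ℤ) : SplitQuaternion) *
      ((((otherCycleMins σ j).reverse).map (colCycleProd A σ)).prod * colCycleProd A σ j)

/-- The determinant of a Hermitian matrix: the common value of all row and column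
determinants (here given as `rdet` at the index `0`). -/
def hdet [NeZero n] (A : Matrix (Fin n) (Fin n) SplitQuaternion) : SplitQuaternion :=
  rdet A 0


/-- The permutation obtained from `σ` by inverting its cycle through `s`. -/
def reverseCycle (σ : Equiv.Perm (Fin n)) (s : Fin n) : Equiv.Perm (Fin n) :=
  σ * (σ.cycleOf s)⁻¹ * (σ.cycleOf s)⁻¹

theorem sign_reverseCycle (σ : Equiv.Perm (Fin n)) (s : Fin n) :
    Equiv.Perm.sign (reverseCycle σ s) = Equiv.Perm.sign σ := by
  simp [reverseCycle, mul_assoc]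

theorem reverseCycle_apply_of_sameCycle {σ : Equiv.Perm (Fin n)} {s t : Fin n}
    (h : σ.SameCycle s t) : reverseCycle σ s t = σ⁻¹ t := by
  simp [reverseCycle, Equiv.Perm.cycleOf_inv, Equiv.Perm.cycleOf_apply, h]

theorem reverseCycle_apply_of_not_sameCycle {σ : Equiv.Perm (Fin n)} {s t : Fin n}
    (h : ¬ σ.SameCycle s t) : reverseCycle σ s t = σ t := by
  simp [reverseCycle, Equiv.Perm.cycleOf_inv, Equiv.Perm.cycleOf_apply, h]

theorem reverseCycle_pow_apply_of_sameCycle {σ : Equiv.Perm (Fin n)} {s t : Fin n}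
    (h : σ.SameCycle s t) (m : ℕ) : (reverseCycle σ s ^ m) t = (σ⁻¹ ^ m) t := by
  induction m with
  | zero => rfl
  | succ m ih =>
    rw [pow_succ', pow_succ', Equiv.Perm.mul_apply, Equiv.Perm.mul_apply, ih]
    refine reverseCycle_apply_of_sameCycle ?_
    rwa [← Equiv.Perm.sameCycle_inv, Equiv.Perm.sameCycle_pow_right, Equiv.Perm.sameCycle_inv]

theorem reverseCycle_pow_apply_of_not_sameCycle {σ : Equiv.Perm (Fin n)} {s t : Fin n}
    (h : ¬ σ.SameCycle s t) (m : ℕ) : (reverseCycle σ s ^ m) t = (σ ^ m) t := by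
  induction m with
  | zero => rfl
  | succ m ih =>
    rw [pow_succ', pow_succ', Equiv.Perm.mul_apply, Equiv.Perm.mul_apply, ih]
    refine reverseCycle_apply_of_not_sameCycle ?_
    rwa [Equiv.Perm.sameCycle_pow_right]

theorem sameCycle_reverseCycle {σ : Equiv.Perm (Fin n)} {s a b : Fin n} :
    (reverseCycle σ s).SameCycle a b ↔ σ.SameCycle a b := by
  by_cases h : σ.SameCycle s a
  · rw [← Equiv.Perm.sameCycle_inv (f := σ)]
    constructor
    · rintro hab
      obtain ⟨m, rfl⟩ := hab.exists_nat_pow_eq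
      exact ⟨m, by rw [reverseCycle_pow_apply_of_sameCycle h, zpow_natCast]⟩
    · rintro hab
      obtain ⟨m, rfl⟩ := hab.exists_nat_pow_eq
      exact ⟨m, by rw [zpow_natCast, reverseCycle_pow_apply_of_sameCycle h]⟩
  · constructor
    · rintro hab
      obtain ⟨m, rfl⟩ := hab.exists_nat_pow_eq
      exact ⟨m, by rw [reverseCycle_pow_apply_of_not_sameCycle h, zpow_natCast]⟩
    · rintro hab
      obtain ⟨m, rfl⟩ := hab.exists_nat_pow_eq
      exact ⟨m, by rw [zpow_natCast, reverseCycle_pow_apply_of_not_sameCycle h]⟩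

theorem reverseCycle_reverseCycle (σ : Equiv.Perm (Fin n)) (s : Fin n) :
    reverseCycle (reverseCycle σ s) s = σ := by
  ext t
  congr 1
  by_cases h : σ.SameCycle s t
  · rw [reverseCycle_apply_of_sameCycle (sameCycle_reverseCycle.2 h),
      Equiv.Perm.inv_eq_iff_eq, reverseCycle_apply_of_sameCycle
        (Equiv.Perm.sameCycle_apply_right.2 h),
      ← Equiv.Perm.mul_apply, inv_mul_cancel, Equiv.Perm.one_apply]
  · rw [reverseCycle_apply_of_not_sameCycle (mt sameCycle_reverseCycle.1 h),
      reverseCycle_apply_of_not_sameCycle h]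

theorem minimalPeriod_eq_of_pow_apply_eq {σ τ : Equiv.Perm (Fin n)} {t : Fin n}
    (h : ∀ m : ℕ, (σ ^ m) t = (τ ^ m) t) :
    Function.minimalPeriod σ t = Function.minimalPeriod τ t := by
  rw [Function.minimalPeriod_eq_minimalPeriod_iff]
  intro m
  simp [Function.IsPeriodicPt, Function.IsFixedPt, Equiv.Perm.iterate_eq_pow, h]

theorem minimalPeriod_perm_inv (σ : Equiv.Perm (Fin n)) (t : Fin n) :
    Function.minimalPeriod (σ⁻¹ : Equiv.Perm (Fin n)) t = Function.minimalPeriod σ t := by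
  rw [Function.minimalPeriod_eq_minimalPeriod_iff]
  intro m
  simp only [Function.IsPeriodicPt, Function.IsFixedPt, Equiv.Perm.iterate_eq_pow, inv_pow,
    Equiv.Perm.inv_eq_iff_eq]
  exact eq_comm

theorem pow_minimalPeriod_apply (σ : Equiv.Perm (Fin n)) (t : Fin n) :
    (σ ^ Function.minimalPeriod σ t) t = t := by
  rw [← Equiv.Perm.iterate_eq_pow]
  exact Function.iterate_minimalPeriod

theorem minimalPeriod_perm_pos (σ : Equiv.Perm (Fin n)) (t : Fin n) :
    0 < Function.minimalPeriod σ t :=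
  Function.minimalPeriod_pos_of_mem_periodicPts
    (σ.injective.mem_periodicPts t)

theorem rowCycleProd_eq_of_pow_apply_eq (A : Matrix (Fin n) (Fin n) SplitQuaternion)
    {σ τ : Equiv.Perm (Fin n)} {t : Fin n} (h : ∀ m : ℕ, (σ ^ m) t = (τ ^ m) t) :
    rowCycleProd A σ t = rowCycleProd A τ t := by
  simp only [rowCycleProd, h, minimalPeriod_eq_of_pow_apply_eq h]

theorem rowCycleProd_inv (A : Matrix (Fin n) (Fin n) SplitQuaternion)
    (σ : Equiv.Perm (Fin n)) (t : Fin n) :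
    rowCycleProd A σ⁻¹ t = colCycleProd A σ t := by
  have key : ∀ m ≤ Function.minimalPeriod σ t,
      (σ⁻¹ ^ m) t = (σ ^ (Function.minimalPeriod σ t - m)) t := by
    intro m hm
    rw [inv_pow, Equiv.Perm.inv_eq_iff_eq, ← Equiv.Perm.mul_apply, ← pow_add,
      Nat.add_sub_cancel' hm, pow_minimalPeriod_apply]
  rw [rowCycleProd, colCycleProd, minimalPeriod_perm_inv]
  congr 1
  refine List.ext_getElem (by simp) fun m h₁ _ => ?_
  simp only [List.length_map, List.length_range] at h₁
  simp only [List.getElem_map, List.getElem_range, List.getElem_reverse, List.length_map,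
    List.length_range]
  rw [key m h₁.le, key (m + 1) h₁]
  congr 3 <;> omega

theorem star_list_prod {R : Type*} [Monoid R] [StarMul R] (l : List R) :
    star l.prod = (l.map star).reverse.prod := by
  induction l with
  | nil => simp
  | cons a l ih => simp [ih]

theorem colCycleProd_eq_star {A : Matrix (Fin n) (Fin n) SplitQuaternion} (hA : A.IsHermitian)
    (σ : Equiv.Perm (Fin n)) (t : Fin n) :
    colCycleProd A σ t = star (rowCycleProd A σ t) := by
  simp only [colCycleProd, rowCycleProd, star_list_prod, List.map_map, Function.comp_def,
    hA.apply]

theorem rowCycleProd_reverseCycle_of_sameCycle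
    {A : Matrix (Fin n) (Fin n) SplitQuaternion} (hA : A.IsHermitian)
    {σ : Equiv.Perm (Fin n)} {s t : Fin n} (h : σ.SameCycle s t) :
    rowCycleProd A (reverseCycle σ s) t = star (rowCycleProd A σ t) := by
  rw [rowCycleProd_eq_of_pow_apply_eq A (reverseCycle_pow_apply_of_sameCycle h),
    rowCycleProd_inv, colCycleProd_eq_star hA]

theorem rowCycleProd_reverseCycle_of_not_sameCycle
    (A : Matrix (Fin n) (Fin n) SplitQuaternion)
    {σ : Equiv.Perm (Fin n)} {s t : Fin n} (h : ¬ σ.SameCycle s t) :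
    rowCycleProd A (reverseCycle σ s) t = rowCycleProd A σ t :=
  rowCycleProd_eq_of_pow_apply_eq A (reverseCycle_pow_apply_of_not_sameCycle h)

theorem re_mul_comm (x y : SplitQuaternion) : (x * y).re = (y * x).re := by
  simp only [QuaternionAlgebra.re_mul]
  ring

theorem re_rowCycleProd_apply (A : Matrix (Fin n) (Fin n) SplitQuaternion)
    (σ : Equiv.Perm (Fin n)) (t : Fin n) :
    (rowCycleProd A σ (σ t)).re = (rowCycleProd A σ t).re := by
  have hL : Function.minimalPeriod σ (σ t) = Function.minimalPeriod σ t :=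
    Function.minimalPeriod_apply (σ.injective.mem_periodicPts t)
  obtain ⟨k, hk⟩ := Nat.exists_eq_succ_of_ne_zero (minimalPeriod_perm_pos σ t).ne'
  have hk' := pow_minimalPeriod_apply σ t
  rw [hk, Nat.succ_eq_add_one] at hk'
  have hs : ∀ m : ℕ, (σ ^ m) (σ t) = (σ ^ (m + 1)) t := fun m => by
    rw [pow_succ, Equiv.Perm.mul_apply]
  have h₁ : rowCycleProd A σ (σ t) =
      ((List.range k).map (fun m => A ((σ ^ (m + 1)) t) ((σ ^ (m + 2)) t))).prod *
        A t (σ t) := by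
    rw [rowCycleProd, hL, hk, Nat.succ_eq_add_one, List.range_succ, List.map_append,
      List.prod_append]
    simp only [List.map_cons, List.map_nil, List.prod_cons, List.prod_nil, mul_one]
    have hk'' : (σ ^ (k + 1 + 1)) t = σ t := by
      rw [pow_succ' σ (k + 1), Equiv.Perm.mul_apply, hk']
    simp only [hs, hk', hk'']
  have h₂ : rowCycleProd A σ t = A t (σ t) *
      ((List.range k).map (fun m => A ((σ ^ (m + 1)) t) ((σ ^ (m + 2)) t))).prod := by
    rw [rowCycleProd, hk, Nat.succ_eq_add_one, List.range_succ_eq_map, List.map_cons,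
      List.prod_cons, List.map_map]
    simp [Function.comp_def]
  rw [h₁, h₂, re_mul_comm]

theorem re_rowCycleProd_eq_of_sameCycle (A : Matrix (Fin n) (Fin n) SplitQuaternion)
    {σ : Equiv.Perm (Fin n)} {s t : Fin n} (h : σ.SameCycle s t) :
    (rowCycleProd A σ s).re = (rowCycleProd A σ t).re := by
  obtain ⟨m, rfl⟩ := h.exists_nat_pow_eq
  induction m with
  | zero => rfl
  | succ m ih =>
    rw [pow_succ', Equiv.Perm.mul_apply, re_rowCycleProd_apply]
    exact ih ⟨m, by rw [zpow_natCast]⟩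

theorem colCycleProd_updateRow_of_not_sameCycle (A : Matrix (Fin n) (Fin n) SplitQuaternion)
    (v : Fin n → SplitQuaternion) {σ : Equiv.Perm (Fin n)} {i s : Fin n}
    (h : ¬ σ.SameCycle i s) :
    colCycleProd (A.updateRow i v) σ s = colCycleProd A σ s := by
  have hne : ∀ m : ℕ, (σ ^ m) s ≠ i := by
    rintro m rfl
    exact h (Equiv.Perm.sameCycle_pow_left.2 (Equiv.Perm.SameCycle.refl _ _))
  simp only [colCycleProd, Matrix.updateRow_ne (hne _)]

theorem colCycleProd_updateRow_mul_left (A : Matrix (Fin n) (Fin n) SplitQuaternion)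
    (b : SplitQuaternion) (σ : Equiv.Perm (Fin n)) (i : Fin n) :
    colCycleProd (A.updateRow i (fun q => b * A i q)) σ i = b * colCycleProd A σ i := by
  obtain ⟨k, hk⟩ := Nat.exists_eq_succ_of_ne_zero (minimalPeriod_perm_pos σ i).ne'
  have hk' := pow_minimalPeriod_apply σ i
  have hne : ∀ m ∈ List.range k, (σ ^ (m + 1)) i ≠ i := by
    intro m hm h
    rw [← Equiv.Perm.iterate_eq_pow] at h
    have hp : Function.IsPeriodicPt σ (m + 1) i := h
    have := hp.minimalPeriod_le m.succ_pos
    have := List.mem_range.1 hm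
    omega
  rw [hk, Nat.succ_eq_add_one] at hk'
  simp only [colCycleProd, hk, Nat.succ_eq_add_one, List.range_succ, List.map_append,
    List.reverse_append, List.prod_append, List.map_cons, List.map_nil,
    List.reverse_singleton, List.prod_singleton, hk', Matrix.updateRow_self, mul_assoc]
  congr 4
  refine List.map_congr_left fun m hm => ?_
  rw [Matrix.updateRow_ne (hne m hm)]

theorem sum_mul_list_prod_eq_sum_mul_re {ι P : Type*} [Fintype P] (φ : ι → P → P)
    (hφ : ∀ s, Function.Involutive (φ s)) (c : ι → SplitQuaternion)
    (x : P → ι → SplitQuaternion)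
    (hx : ∀ s σ t, t ≠ s → x (φ s σ) t = x σ t)
    (hstar : ∀ s σ, x (φ s σ) s = star (x σ s)) (l : List ι) (hl : l.Nodup)
    (y : P → SplitQuaternion) (hy : ∀ s ∈ l, ∀ σ, y (φ s σ) = y σ) :
    ∑ σ, y σ * (l.map fun s => c s * x σ s).prod =
      ∑ σ, y σ * (l.map fun s => c s * ((x σ s).re : SplitQuaternion)).prod := by
  induction l generalizing y with
  | nil => rfl
  | cons s l ih =>
    obtain ⟨hs, hl⟩ := List.nodup_cons.1 hl
    have hne : ∀ t ∈ l, t ≠ s := fun t ht h => hs (h ▸ ht)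
    simp only [List.map_cons, List.prod_cons, ← mul_assoc]
    have h₁ := ih hl (fun σ => y σ * c s * x σ s) fun t ht σ => by
      rw [hy t (List.mem_cons_of_mem _ ht), hx t σ s (hne t ht).symm]
    rw [h₁]
    let z : P → SplitQuaternion :=
      fun σ => (l.map fun t => c t * ((x σ t).re : SplitQuaternion)).prod
    have hz : ∀ σ, z (φ s σ) = z σ := fun σ => by
      simp only [z]
      congr 1
      exact List.map_congr_left fun t ht => by rw [hx s σ t (hne t ht)]
    change ∑ σ, y σ * c s * x σ s * z σ =
      ∑ σ, y σ * c s * ((x σ s).re : SplitQuaternion) * z σ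
    have h₂ : ∑ σ, y σ * c s * x σ s * z σ = ∑ σ, y σ * c s * star (x σ s) * z σ := by
      rw [← Equiv.sum_comp (hφ s).toPerm]
      simp [hz, hstar, hy s (List.mem_cons_self)]
    have h₃ : ∀ q : SplitQuaternion, (2 : ℝ) • (q.re : SplitQuaternion) = q + star q := fun q => by
      ext <;> simp
      ring
    refine smul_right_injective _ (two_ne_zero (α := ℝ)) ?_
    simp only [Finset.smul_sum]
    have h₄ : ∀ σ, (2 : ℝ) • (y σ * c s * ((x σ s).re : SplitQuaternion) * z σ) =
        y σ * c s * x σ s * z σ + y σ * c s * star (x σ s) * z σ := fun σ => by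
      rw [← smul_mul_assoc, ← mul_smul_comm, h₃, mul_add, add_mul]
    simp only [h₄, Finset.sum_add_distrib, ← h₂, two_smul]

/-- `s` is the least element of a cycle of `σ` that does not contain `i`. -/
def IsOtherCycleMin (σ : Equiv.Perm (Fin n)) (i s : Fin n) : Prop :=
  (∀ t, σ.SameCycle s t → s ≤ t) ∧ ¬ σ.SameCycle i s

theorem isOtherCycleMin_reverseCycle {σ : Equiv.Perm (Fin n)} {i s t : Fin n} :
    IsOtherCycleMin (reverseCycle σ t) i s ↔ IsOtherCycleMin σ i s := by
  simp only [IsOtherCycleMin, sameCycle_reverseCycle]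

theorem IsOtherCycleMin.not_sameCycle {σ : Equiv.Perm (Fin n)} {i s t : Fin n}
    (hs : IsOtherCycleMin σ i s) (ht : IsOtherCycleMin σ i t) (hst : t ≠ s) :
    ¬ σ.SameCycle s t := fun h =>
  hst (le_antisymm (ht.1 s h.symm) (hs.1 t h))

open scoped Classical in
/-- A factor of the ordered product attached to `σ` in a row or column determinant at `i`:
`none` stands for the cycle through `i` and `some s` for the cycle with least element `s`. -/
def cycleFactor (F : Fin n → SplitQuaternion) (σ : Equiv.Perm (Fin n)) (i : Fin n) :
    Option (Fin n) → SplitQuaternion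
  | none => F i
  | some s => if IsOtherCycleMin σ i s then F s else 1

open scoped Classical in
/-- Reversal of the cycle of `σ` labelled as in `cycleFactor`. -/
def reverseFactor (i : Fin n) : Option (Fin n) → Equiv.Perm (Fin n) → Equiv.Perm (Fin n)
  | none, σ => reverseCycle σ i
  | some s, σ => if IsOtherCycleMin σ i s then reverseCycle σ s else σ

theorem reverseFactor_involutive (i : Fin n) (s : Option (Fin n)) :
    Function.Involutive (reverseFactor i s) := by
  intro σ
  cases s with
  | none => exact reverseCycle_reverseCycle σ i
  | some s =>
    by_cases h : IsOtherCycleMin σ i s <;>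
      simp [reverseFactor, h, isOtherCycleMin_reverseCycle, reverseCycle_reverseCycle]

theorem sign_reverseFactor (i : Fin n) (s : Option (Fin n)) (σ : Equiv.Perm (Fin n)) :
    Equiv.Perm.sign (reverseFactor i s σ) = Equiv.Perm.sign σ := by
  cases s with
  | none => exact sign_reverseCycle σ i
  | some s => by_cases h : IsOtherCycleMin σ i s <;> simp [reverseFactor, h, sign_reverseCycle]

theorem cycleFactor_reverseFactor_self {F : Equiv.Perm (Fin n) → Fin n → SplitQuaternion}
    (hF : ∀ σ s, F (reverseCycle σ s) s = star (F σ s)) (σ : Equiv.Perm (Fin n)) (i : Fin n)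
    (s : Option (Fin n)) :
    cycleFactor (F (reverseFactor i s σ)) (reverseFactor i s σ) i s =
      star (cycleFactor (F σ) σ i s) := by
  cases s with
  | none => exact hF σ i
  | some s =>
    by_cases h : IsOtherCycleMin σ i s <;>
      simp [reverseFactor, cycleFactor, h, isOtherCycleMin_reverseCycle, hF]

theorem cycleFactor_reverseFactor_of_ne {F : Equiv.Perm (Fin n) → Fin n → SplitQuaternion}
    (hF : ∀ σ s t, ¬ σ.SameCycle s t → F (reverseCycle σ s) t = F σ t)
    (σ : Equiv.Perm (Fin n)) (i : Fin n) {s t : Option (Fin n)} (hst : t ≠ s) :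
    cycleFactor (F (reverseFactor i s σ)) (reverseFactor i s σ) i t =
      cycleFactor (F σ) σ i t := by
  cases s with
  | none =>
    cases t with
    | none => exact absurd rfl hst
    | some t =>
      by_cases h : IsOtherCycleMin σ i t <;>
        simp [reverseFactor, cycleFactor, h, isOtherCycleMin_reverseCycle]
      exact hF _ _ _ h.2
  | some s =>
    by_cases hs : IsOtherCycleMin σ i s
    · cases t with
      | none => simpa [reverseFactor, cycleFactor, hs] using hF _ _ _ (mt (·.symm) hs.2)
      | some t =>
        by_cases h : IsOtherCycleMin σ i t <;>
          simp [reverseFactor, cycleFactor, hs, h, isOtherCycleMin_reverseCycle]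
        exact hF _ _ _ (hs.not_sameCycle h (by simpa using hst))
    · simp [reverseFactor, hs]

theorem list_map_filter_prod {M ι : Type*} [Monoid M] (p : ι → Prop) [DecidablePred p]
    (f : ι → M) (l : List ι) :
    ((l.filter p).map f).prod = (l.map fun s => if p s then f s else 1).prod := by
  induction l with
  | nil => rfl
  | cons a l ih => by_cases h : p a <;> simp [h, ih]

open scoped Classical in
theorem otherCycleMins_eq_filter (σ : Equiv.Perm (Fin n)) (i : Fin n) :
    otherCycleMins σ i = (List.finRange n).filter (IsOtherCycleMin σ i) := by
  rw [← (List.toFinset_sort (· ≤ ·) ((List.nodup_finRange n).filter _)).2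
    ((List.pairwise_le_finRange n).filter _), otherCycleMins]
  congr 1
  ext s
  simp only [Finset.mem_filter, Finset.mem_univ, true_and, List.mem_toFinset, List.mem_filter,
    List.mem_finRange, decide_eq_true_eq]
  rfl

theorem otherCycleMins_map_prod (F : Fin n → SplitQuaternion) (σ : Equiv.Perm (Fin n))
    (i : Fin n) :
    ((otherCycleMins σ i).map F).prod =
      ((List.finRange n).map fun s => cycleFactor F σ i (some s)).prod := by
  classical
  rw [otherCycleMins_eq_filter, list_map_filter_prod]
  rfl

theorem otherCycleMins_reverse_map_prod (F : Fin n → SplitQuaternion)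
    (σ : Equiv.Perm (Fin n)) (i : Fin n) :
    ((otherCycleMins σ i).reverse.map F).prod =
      ((List.finRange n).reverse.map fun s => cycleFactor F σ i (some s)).prod := by
  classical
  rw [otherCycleMins_eq_filter, ← List.filter_reverse, list_map_filter_prod]
  rfl

open scoped Classical in
theorem re_cycleFactor_mul_prod (A : Matrix (Fin n) (Fin n) SplitQuaternion)
    (σ : Equiv.Perm (Fin n)) (i : Fin n) :
    (cycleFactor (rowCycleProd A σ) σ i none).re *
        ∏ s, (cycleFactor (rowCycleProd A σ) σ i (some s)).re =
      ∏ q : Quotient (Equiv.Perm.SameCycle.setoid σ), (rowCycleProd A σ q.out).re := by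
  have hi : i ∉ Finset.univ.filter (IsOtherCycleMin σ i) := fun h =>
    (Finset.mem_filter.1 h).2.2 (Equiv.Perm.SameCycle.refl _ _)
  have h₁ : ∀ s, (cycleFactor (rowCycleProd A σ) σ i (some s)).re =
      if IsOtherCycleMin σ i s then (rowCycleProd A σ s).re else 1 := fun s => by
    by_cases h : IsOtherCycleMin σ i s <;> simp [cycleFactor, h]
  simp only [h₁]
  rw [← Finset.prod_filter]
  change (rowCycleProd A σ i).re * _ = _
  rw [← Finset.prod_insert (f := fun s => (rowCycleProd A σ s).re) hi]
  refine Finset.prod_bij (fun s _ => Quotient.mk (Equiv.Perm.SameCycle.setoid σ) s)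
    (fun _ _ => Finset.mem_univ _) ?_ ?_ ?_
  · intro s hs t ht hst
    have hst : σ.SameCycle s t := Quotient.exact hst
    by_contra hne
    simp only [Finset.mem_insert, Finset.mem_filter, Finset.mem_univ, true_and] at hs ht
    rcases hs with rfl | hs <;> rcases ht with rfl | ht
    · exact hne rfl
    · exact ht.2 hst
    · exact hs.2 hst.symm
    · exact hs.not_sameCycle ht (Ne.symm hne) hst
  · intro q _
    induction q using Quotient.inductionOn with
    | h t =>
      by_cases hit : σ.SameCycle i t
      · exact ⟨i, Finset.mem_insert_self _ _, Quotient.sound hit⟩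
      · obtain ⟨s, hs, hmin⟩ := Finset.exists_min_image
          (Finset.univ.filter fun s => σ.SameCycle t s) id ⟨t, by simp [Equiv.Perm.SameCycle.refl]⟩
        simp only [Finset.mem_filter, Finset.mem_univ, true_and, id] at hs hmin
        refine ⟨s, ?_, Quotient.sound hs.symm⟩
        simp only [Finset.mem_insert, Finset.mem_filter, Finset.mem_univ, true_and]
        exact Or.inr ⟨fun u hu => hmin u (hs.trans hu), fun h => hit (h.trans hs.symm)⟩
  · intro s _
    refine re_rowCycleProd_eq_of_sameCycle A ?_
    exact (Quotient.mk_out (s := Equiv.Perm.SameCycle.setoid σ) s).symm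

theorem coe_list_prod {ι : Type*} (f : ι → ℝ) (l : List ι) :
    (l.map fun s => (f s : SplitQuaternion)).prod = (((l.map f).prod : ℝ) : SplitQuaternion) := by
  induction l with
  | nil => simp
  | cons a l ih => simp [ih]

open scoped Classical in
/-- The real form of the determinant of a Hermitian matrix: every cycle contributes the real part
of its ordered product. -/
theorem rdet_eq_sum_prod_re {A : Matrix (Fin n) (Fin n) SplitQuaternion} (hA : A.IsHermitian)
    (i : Fin n) :
    rdet A i = ∑ σ : Equiv.Perm (Fin n), ((Equiv.Perm.sign σ : ℤ) : SplitQuaternion) *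
      ((∏ q : Quotient (Equiv.Perm.SameCycle.setoid σ), (rowCycleProd A σ q.out).re : ℝ) :
        SplitQuaternion) := by
  have h := sum_mul_list_prod_eq_sum_mul_re (reverseFactor i) (reverseFactor_involutive i)
    (fun _ => 1) (fun σ => cycleFactor (rowCycleProd A σ) σ i)
    (fun s σ t => cycleFactor_reverseFactor_of_ne
      (fun _ _ _ => rowCycleProd_reverseCycle_of_not_sameCycle A) σ i)
    (fun s σ => cycleFactor_reverseFactor_self
      (fun σ s => rowCycleProd_reverseCycle_of_sameCycle hA (.refl σ s)) σ i s)
    (none :: (List.finRange n).map some)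
    (by simp [List.nodup_map_iff (Option.some_injective _), List.nodup_finRange])
    (fun σ => ((Equiv.Perm.sign σ : ℤ) : SplitQuaternion))
    (fun s _ σ => by rw [sign_reverseFactor])
  simp only [one_mul, List.map_cons, List.map_map, List.prod_cons, Function.comp_def] at h
  simp only [rdet, otherCycleMins_map_prod]
  refine h.trans (Finset.sum_congr rfl fun σ _ => ?_)
  rw [coe_list_prod, ← QuaternionAlgebra.coe_mul, ← Fin.prod_univ_def,
    re_cycleFactor_mul_prod]

open scoped Classical in
theorem cdet_updateRow_mul_left_eq_sum_prod_re {A : Matrix (Fin n) (Fin n) SplitQuaternion}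
    (hA : A.IsHermitian) (b : SplitQuaternion) (i : Fin n) :
    cdet (A.updateRow i (fun q => b * A i q)) i =
      ∑ σ : Equiv.Perm (Fin n), ((Equiv.Perm.sign σ : ℤ) : SplitQuaternion) *
        (b * ((∏ q : Quotient (Equiv.Perm.SameCycle.setoid σ), (rowCycleProd A σ q.out).re : ℝ) :
          SplitQuaternion)) := by
  have h := sum_mul_list_prod_eq_sum_mul_re (reverseFactor i) (reverseFactor_involutive i)
    (fun s => s.elim b fun _ => 1) (fun σ => cycleFactor (colCycleProd A σ) σ i)
    (fun s σ t => cycleFactor_reverseFactor_of_ne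
      (fun _ _ _ h => by
        rw [colCycleProd_eq_star hA, colCycleProd_eq_star hA,
          rowCycleProd_reverseCycle_of_not_sameCycle A h]) σ i)
    (fun s σ => cycleFactor_reverseFactor_self
      (fun σ s => by
        rw [colCycleProd_eq_star hA, colCycleProd_eq_star hA,
          rowCycleProd_reverseCycle_of_sameCycle hA (.refl σ s)]) σ i s)
    ((List.finRange n).reverse.map some ++ [none])
    (by
      rw [List.nodup_append]
      simp [List.nodup_map_iff (Option.some_injective _), List.nodup_finRange])
    (fun σ => ((Equiv.Perm.sign σ : ℤ) : SplitQuaternion))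
    (fun s _ σ => by rw [sign_reverseFactor])
  have hre : ∀ σ s, (cycleFactor (colCycleProd A σ) σ i s).re =
      (cycleFactor (rowCycleProd A σ) σ i s).re := by
    intro σ s
    cases s with
    | none => simp [cycleFactor, colCycleProd_eq_star hA]
    | some s =>
      by_cases h : IsOtherCycleMin σ i s <;> simp [cycleFactor, h, colCycleProd_eq_star hA]
  simp only [one_mul, List.map_append, List.map_cons, List.map_nil, List.map_map,
    List.prod_append, List.prod_singleton, Function.comp_def, Option.elim] at h
  have hcol : ∀ σ, (((otherCycleMins σ i).reverse).map
      (colCycleProd (A.updateRow i (fun q => b * A i q)) σ)).prod =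
      (((otherCycleMins σ i).reverse).map (colCycleProd A σ)).prod := fun σ => by
    congr 1
    refine List.map_congr_left fun s hs => colCycleProd_updateRow_of_not_sameCycle A _ ?_
    simp only [otherCycleMins_eq_filter, List.mem_reverse, List.mem_filter,
      decide_eq_true_eq] at hs
    exact hs.2.2
  simp only [cdet, hcol, otherCycleMins_reverse_map_prod, colCycleProd_updateRow_mul_left]
  refine h.trans (Finset.sum_congr rfl fun σ _ => ?_)
  simp only [hre]
  rw [coe_list_prod, List.map_reverse, List.prod_reverse, ← re_cycleFactor_mul_prod A σ i,
    ← Fin.prod_univ_def, QuaternionAlgebra.coe_commutes, QuaternionAlgebra.coe_mul, mul_assoc]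

/-- If the `i`-th row of a Hermitian matrix `A` is left-multiplied by `b`, then
the `i`-th column determinant of the resulting matrix equals `b · det A`. -/
theorem cdet_updateRow_mul_left_of_isHermitian [NeZero n]
    (A : Matrix (Fin n) (Fin n) SplitQuaternion) (hA : A.IsHermitian)
    (b : SplitQuaternion) :
    ∀ i : Fin n, cdet (A.updateRow i (fun q => b * A i q)) i = b * hdet A := by
  intro i
  classical
  rw [cdet_updateRow_mul_left_eq_sum_prod_re hA, hdet, rdet_eq_sum_prod_re hA, Finset.mul_sum]
  refine Finset.sum_congr rfl fun σ _ => ?_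
  rw [← mul_assoc, ← mul_assoc, (Int.cast_commute _ b).eq]

end SplitQuaternion

end
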